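/- The Edmonds–Giles conjecture is true if and only if for every undirected graph G and every positive integer τ, every τ-strongly-connected orientation vector of G can be decomposed into τ characteristic vectors of strongly connected orientations. -/

import Mathlib

open Finset

/-- The arcs leaving the vertex set `U`. -/
def outArcs {V A : Type*} [DecidableEq V] [Fintype A] (src tgt : A → V) (U : Finset V) :
    Finset A :=
  univ.filter fun a => src a ∈ U ∧ tgt a ∉ U

/-- The arcs entering the vertex set `U`. -/
def inArcs {V A : Type*} [DecidableEq V] [Fintype A] (src tgt : A → V) (U : Finset V) :
    Finset A :=
  univ.filter fun a => tgt a ∈ U ∧ src a ∉ U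

/-- `U` induces a dicut: nonempty, proper, no entering arcs (the dicut is `outArcs U`). -/
def IsDicut {V A : Type*} [Fintype V] [DecidableEq V] [Fintype A] (src tgt : A → V)
    (U : Finset V) : Prop :=
  U.Nonempty ∧ U ≠ univ ∧ inArcs src tgt U = ∅

/-- A dijoin: an arc set meeting every dicut. -/
def IsDijoin {V A : Type*} [Fintype V] [DecidableEq V] [Fintype A] [DecidableEq A] (src tgt : A → V)
    (J : Finset A) : Prop :=
  ∀ U : Finset V, IsDicut src tgt U → (outArcs src tgt U ∩ J).Nonempty

/-- Source of an arc of the bidirected graph `E × Bool`: `(e, true) = e⁺` goes from `s e` to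
`t e`, and `(e, false) = e⁻` goes from `t e` to `s e`. -/
def bsrc {V E : Type*} (s t : E → V) (p : E × Bool) : V := if p.2 then s p.1 else t p.1

/-- Target of an arc of the bidirected graph `E × Bool`. -/
def btgt {V E : Type*} (s t : E → V) (p : E × Bool) : V := if p.2 then t p.1 else s p.1

/-- A strongly connected orientation: a choice `O` of one direction per edge such that every
nonempty proper cut has a leaving arc. -/
def IsSCO {V E : Type*} [Fintype V] [DecidableEq V] [Fintype E] (s t : E → V)
    (O : E → Bool) : Prop :=
  ∀ U : Finset V, U.Nonempty → U ≠ univ →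
    ∃ e : E, (e, O e) ∈ outArcs (bsrc s t) (btgt s t) U

/-- The Edmonds–Giles conjecture: in any digraph with 0/1 arc weights in which every dicut has
weight at least `τ`, there are `τ` dijoins such that each arc `a` lies in at most `w a` of
them. -/
def EdmondsGilesConj : Prop :=
  ∀ (V A : Type) [Fintype V] [DecidableEq V] [Fintype A] [DecidableEq A],
    ∀ (src tgt : A → V) (w : A → ℕ), (∀ a, w a ≤ 1) →
    ∀ τ : ℕ, (∀ U : Finset V, IsDicut src tgt U → τ ≤ ∑ a ∈ outArcs src tgt U, w a) →
    ∃ J : Fin τ → Finset A, (∀ i, IsDijoin src tgt (J i)) ∧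
      ∀ a : A, (Finset.univ.filter fun i => a ∈ J i).card ≤ w a

/-- Every `τ`-strongly-connected orientation vector of every undirected graph decomposes into
`τ` characteristic vectors of strongly connected orientations. -/
def SCODecompProp : Prop :=
  ∀ (V E : Type) [Fintype V] [DecidableEq V] [Fintype E] [DecidableEq E],
    ∀ (s t : E → V) (τ : ℕ), 0 < τ →
    ∀ x : E × Bool → ℤ, (∀ p, 0 ≤ x p) → (∀ e : E, x (e, true) + x (e, false) = (τ : ℤ)) →
    (∀ U : Finset V, U.Nonempty → U ≠ Finset.univ →
      (τ : ℤ) ≤ ∑ p ∈ outArcs (bsrc s t) (btgt s t) U, x p) →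
    ∃ O : Fin τ → (E → Bool), (∀ i, IsSCO s t (O i)) ∧
      ∀ p : E × Bool, x p = ∑ i, (if O i p.1 = p.2 then (1 : ℤ) else 0)

theorem mem_outArcs {V A : Type*} [DecidableEq V] [Fintype A] {src tgt : A → V} {U : Finset V}
    {a : A} : a ∈ outArcs src tgt U ↔ src a ∈ U ∧ tgt a ∉ U := by
  simp [outArcs]

theorem inArcs_eq_empty_iff {V A : Type*} [DecidableEq V] [Fintype A] {src tgt : A → V}
    {U : Finset V} : inArcs src tgt U = ∅ ↔ ∀ a, tgt a ∈ U → src a ∈ U := by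
  simp [inArcs, Finset.filter_eq_empty_iff]

theorem sum_fin_indicator_lt {τ n : ℕ} (h : n ≤ τ) :
    ∑ k : Fin τ, (if (k : ℕ) < n then 1 else 0) = n := by
  rw [Fin.sum_univ_eq_sum_range (fun k => if k < n then 1 else 0) τ, ← Finset.sum_filter,
    Finset.sum_const, smul_eq_mul, mul_one]
  have : (Finset.range τ).filter (· < n) = Finset.range n := by
    ext k
    simp only [Finset.mem_filter, Finset.mem_range]
    omega
  rw [this, Finset.card_range]

/-- Replacing each edge `e` by a new source vertex, with parallel arcs to its two ends, turns
`τ`-strongly-connected orientations into instances of the Edmonds–Giles conjecture. -/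
theorem EdmondsGilesConj.scoDecompProp (h : EdmondsGilesConj) : SCODecompProp := by
  intro V E _ _ _ _ s t τ hτ x hx0 hxτ hcut
  have hxle : ∀ p, (x p).toNat ≤ τ := by
    rintro ⟨e, b⟩
    have h1 := hxτ e
    have h2 := hx0 (e, true)
    have h3 := hx0 (e, false)
    cases b <;> omega
  let src : (E × Bool) × Fin τ → V ⊕ E := fun a => Sum.inr a.1.1
  let tgt : (E × Bool) × Fin τ → V ⊕ E := fun a => Sum.inl (btgt s t a.1)
  let w : (E × Bool) × Fin τ → ℕ := fun a => if (a.2 : ℕ) < (x a.1).toNat then 1 else 0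
  have hw : ∀ p, ∑ k, w (p, k) = (x p).toNat := fun p => sum_fin_indicator_lt (hxle p)
  have hsum : ∀ (U : Finset (V ⊕ E)) (P : Finset (E × Bool)),
      (∀ p ∈ P, ∀ k, (p, k) ∈ outArcs src tgt U) → (τ : ℤ) ≤ ∑ p ∈ P, x p →
      τ ≤ ∑ a ∈ outArcs src tgt U, w a := by
    intro U P hP hle
    have hsub : P ×ˢ (Finset.univ : Finset (Fin τ)) ⊆ outArcs src tgt U := by
      rintro ⟨p, k⟩ hp
      exact hP p (Finset.mem_product.1 hp).1 k
    refine le_trans ?_ (Finset.sum_le_sum_of_subset hsub)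
    rw [Finset.sum_product, Finset.sum_congr rfl fun p _ => hw p]
    zify
    rwa [Finset.sum_congr rfl fun p _ => Int.toNat_of_nonneg (hx0 p)]
  have hdicut : ∀ U, IsDicut src tgt U → τ ≤ ∑ a ∈ outArcs src tgt U, w a := by
    intro U hU
    obtain ⟨⟨u, hu⟩, hne, hin⟩ := hU
    rw [inArcs_eq_empty_iff] at hin
    let X : Finset V := Finset.univ.filter fun v => Sum.inl v ∈ U
    have hX : ∀ v, v ∈ X ↔ Sum.inl v ∈ U := by simp [X]
    have hend : ∀ p : E × Bool, btgt s t p ∈ X → Sum.inr p.1 ∈ U := by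
      intro p hp
      exact hin (p, ⟨0, hτ⟩) ((hX _).1 hp)
    by_cases hXe : X.Nonempty
    · refine hsum U (outArcs (bsrc s t) (btgt s t) X) ?_ (hcut X hXe ?_)
      · rintro ⟨e, b⟩ hp k
        rw [mem_outArcs] at hp ⊢
        refine ⟨?_, fun hc => hp.2 ((hX _).2 hc)⟩
        refine hend (e, !b) ?_
        have := hp.1
        cases b <;> simpa [bsrc, btgt] using this
      · intro hXu
        refine hne (Finset.eq_univ_of_forall ?_)
        rintro (v | e)
        · exact (hX v).1 (hXu ▸ Finset.mem_univ v)
        · exact hend (e, true) (hXu ▸ Finset.mem_univ _)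
    · have hno : ∀ v, Sum.inl v ∉ U := fun v hv => hXe ⟨v, (hX v).2 hv⟩
      rcases u with v | e
      · exact absurd hu (hno v)
      · refine hsum U {(e, true), (e, false)} ?_ ?_
        · intro p hp k
          rw [mem_outArcs]
          refine ⟨?_, hno _⟩
          have : p.1 = e := by
            simp only [Finset.mem_insert, Finset.mem_singleton] at hp
            rcases hp with rfl | rfl <;> rfl
          simpa [src, this] using hu
        · rw [Finset.sum_pair (by simp), hxτ]
  obtain ⟨J, hJ, hJw⟩ := h (V ⊕ E) ((E × Bool) × Fin τ) src tgt w
    (fun a => by simp only [w]; split_ifs <;> omega) τ hdicut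
  have hpick : ∀ i e, ∃ b k, ((e, b), k) ∈ J i := by
    intro i e
    obtain ⟨⟨⟨e', b⟩, k⟩, ha⟩ := hJ i {Sum.inr e} ⟨Finset.singleton_nonempty _, fun hc => by
      have := hc ▸ Finset.mem_univ (Sum.inl (s e) : V ⊕ E)
      simp at this, by simp [inArcs_eq_empty_iff, tgt]⟩
    rw [Finset.mem_inter, mem_outArcs] at ha
    obtain rfl : e' = e := by simpa [src] using ha.1.1
    exact ⟨b, k, ha.2⟩
  choose O K hOK using hpick
  have hused : ∀ p : E × Bool,
      (Finset.univ.filter fun i => ∃ k, (p, k) ∈ J i).card ≤ (x p).toNat := by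
    intro p
    calc (Finset.univ.filter fun i => ∃ k, (p, k) ∈ J i).card
        ≤ (Finset.univ.biUnion fun k => Finset.univ.filter fun i => (p, k) ∈ J i).card := by
          refine Finset.card_le_card fun i hi => ?_
          simpa using hi
      _ ≤ ∑ k, (Finset.univ.filter fun i => (p, k) ∈ J i).card := Finset.card_biUnion_le
      _ ≤ ∑ k, w (p, k) := Finset.sum_le_sum fun k _ => hJw (p, k)
      _ = (x p).toNat := hw p
  have hsub : ∀ p : E × Bool, (Finset.univ.filter fun i => O i p.1 = p.2) ⊆
      Finset.univ.filter fun i => ∃ k, (p, k) ∈ J i := by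
    rintro ⟨e, b⟩ i hi
    obtain rfl : O i e = b := by simpa using hi
    simpa using ⟨K i e, hOK i e⟩
  have hcard : ∀ p : E × Bool,
      (Finset.univ.filter fun i => O i p.1 = p.2).card = (x p).toNat := by
    have hle := fun p => (Finset.card_le_card (hsub p)).trans (hused p)
    rintro ⟨e, b⟩
    have h1 := hle (e, true)
    have h2 := hle (e, false)
    have h3 := Finset.card_filter_add_card_filter_not (s := (Finset.univ : Finset (Fin τ)))
      (fun i => O i e = true)
    simp only [Bool.not_eq_true, Finset.card_univ, Fintype.card_fin] at h1 h2 h3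
    have h4 := hxτ e
    have h5 := hx0 (e, true)
    have h6 := hx0 (e, false)
    cases b <;> simp only <;> omega
  have huniq : ∀ i e b k, ((e, b), k) ∈ J i → O i e = b := by
    intro i e b k hk
    have heq := Finset.eq_of_subset_of_card_le (hsub (e, b)) ((hused _).trans (hcard _).ge)
    have hi : i ∈ Finset.univ.filter fun i => ∃ k, ((e, b), k) ∈ J i := by simpa using ⟨k, hk⟩
    rw [← heq] at hi
    simpa using hi
  refine ⟨O, fun i X hXe hXu => ?_, fun p => ?_⟩
  · let U : Finset (V ⊕ E) := X.disjSum (Finset.univ.filter fun e => s e ∈ X ∨ t e ∈ X)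
    have hUl : ∀ v, Sum.inl v ∈ U ↔ v ∈ X := by simp [U]
    have hUr : ∀ e, Sum.inr e ∈ U ↔ s e ∈ X ∨ t e ∈ X := by simp [U]
    have hU : IsDicut src tgt U := by
      refine ⟨?_, ?_, ?_⟩
      · obtain ⟨v, hv⟩ := hXe
        exact ⟨Sum.inl v, (hUl v).2 hv⟩
      · intro hc
        exact hXu (Finset.eq_univ_of_forall fun v => (hUl v).1 (hc ▸ Finset.mem_univ _))
      · rw [inArcs_eq_empty_iff]
        rintro ⟨⟨e, b⟩, k⟩ ha
        have := (hUl _).1 ha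
        refine (hUr e).2 ?_
        cases b
        · exact Or.inl (by simpa [btgt] using this)
        · exact Or.inr (by simpa [btgt] using this)
    obtain ⟨⟨⟨e, b⟩, k⟩, ha⟩ := hJ i U hU
    rw [Finset.mem_inter, mem_outArcs] at ha
    obtain ⟨⟨h1, h2⟩, h3⟩ := ha
    have h1' := (hUr e).1 h1
    have h2' : btgt s t (e, b) ∉ X := fun hc => h2 ((hUl _).2 hc)
    refine ⟨e, ?_⟩
    rw [huniq i e b k h3, mem_outArcs]
    refine ⟨?_, h2'⟩
    cases b <;> simp [bsrc, btgt] at h2' ⊢ <;> tauto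
  · rw [Finset.sum_boole, hcard p]
    exact (Int.toNat_of_nonneg (hx0 p)).symm

/-- Doubling each arc `a`, one copy always pointing forwards and the other pointing backwards
`w a` times, turns instances of the Edmonds–Giles conjecture into `τ`-strongly-connected
orientations; the backward copies of an orientation in the decomposition form a dijoin. -/
theorem SCODecompProp.edmondsGilesConj (h : SCODecompProp) : EdmondsGilesConj := by
  intro V A _ _ _ _ src tgt w hw τ hτ
  rcases Nat.eq_zero_or_pos τ with rfl | hpos
  · exact ⟨fun i => i.elim0, fun i => i.elim0, by simp⟩
  let s : A × Bool → V := fun e => src e.1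
  let t : A × Bool → V := fun e => tgt e.1
  let back : A × Bool → ℤ := fun e => if e.2 then 0 else (w e.1 : ℤ)
  let x : (A × Bool) × Bool → ℤ := fun p => if p.2 then τ - back p.1 else back p.1
  have hback : ∀ e, 0 ≤ back e ∧ back e ≤ τ := by
    rintro ⟨a, c⟩
    have := hw a
    cases c <;> simp [back]
    omega
  have hx0 : ∀ p, 0 ≤ x p := by
    rintro ⟨e, b⟩
    have := hback e
    cases b <;> simp [x] <;> omega
  obtain ⟨O, hO, hxO⟩ := h V (A × Bool) s t τ hpos x hx0 (fun e => by simp [x]) (by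
    intro U hUe hUu
    by_cases hout : ∃ a, src a ∈ U ∧ tgt a ∉ U
    · obtain ⟨a, ha⟩ := hout
      have hmem : ((a, true), true) ∈ outArcs (bsrc s t) (btgt s t) U := by
        simpa [mem_outArcs, bsrc, btgt, s, t] using ha
      have := Finset.single_le_sum (fun p _ => hx0 p) hmem
      simpa [x, back] using this
    · push Not at hout
      have hd : IsDicut src tgt Uᶜ := by
        refine ⟨?_, ?_, ?_⟩
        · rwa [Finset.nonempty_iff_ne_empty, Ne, Finset.compl_eq_empty_iff]
        · rw [Ne, Finset.compl_eq_univ_iff]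
          exact hUe.ne_empty
        · rw [inArcs_eq_empty_iff]
          intro a ha
          rw [Finset.mem_compl] at ha ⊢
          exact fun hc => ha (hout a hc)
      have hle := hτ _ hd
      let f : A → (A × Bool) × Bool := fun a => ((a, false), false)
      have hf : Function.Injective f := fun a b hab => by simpa [f] using hab
      have hsub : (outArcs src tgt Uᶜ).image f ⊆ outArcs (bsrc s t) (btgt s t) U := by
        intro p hp
        obtain ⟨a, ha, rfl⟩ := Finset.mem_image.1 hp
        rw [mem_outArcs, Finset.mem_compl, Finset.mem_compl, not_not] at ha
        simpa [mem_outArcs, f, bsrc, btgt, s, t] using ha.symm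
      have hle' := Finset.sum_le_sum_of_subset_of_nonneg hsub fun p _ _ => hx0 p
      rw [Finset.sum_image hf.injOn] at hle'
      refine le_trans ?_ hle'
      simpa [f, x, back] using (by exact_mod_cast hle :
        (τ : ℤ) ≤ ∑ a ∈ outArcs src tgt Uᶜ, (w a : ℤ)))
  have hforward : ∀ i a, O i (a, true) = true := by
    intro i a
    have h0 := hxO ((a, true), false)
    rw [Finset.sum_boole, eq_comm] at h0
    simp only [x, back, Bool.false_eq_true, if_false, if_true, Nat.cast_eq_zero,
      Finset.card_eq_zero, Finset.filter_eq_empty_iff, Bool.not_eq_false] at h0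
    exact h0 (Finset.mem_univ i)
  refine ⟨fun i => Finset.univ.filter fun a => O i (a, false) = false, fun i U hU => ?_,
    fun a => ?_⟩
  · obtain ⟨hUe, hUu, hin⟩ := hU
    rw [inArcs_eq_empty_iff] at hin
    obtain ⟨⟨a, c⟩, he⟩ := hO i Uᶜ
      (by rwa [Finset.nonempty_iff_ne_empty, Ne, Finset.compl_eq_empty_iff])
      (by rw [Ne, Finset.compl_eq_univ_iff]; exact hUe.ne_empty)
    rw [mem_outArcs, Finset.mem_compl, Finset.mem_compl, not_not] at he
    rcases hb : O i (a, c) with _ | _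
    · have hc : c = false := by
        cases c
        · rfl
        · simp [hforward] at hb
      subst hc
      refine ⟨a, ?_⟩
      rw [hb] at he
      simpa [mem_outArcs, hb, bsrc, btgt, s, t] using he.symm
    · rw [hb] at he
      simp only [bsrc, btgt, s, t, if_true] at he
      exact absurd (hin a he.2) he.1
  · have h0 := hxO ((a, false), false)
    rw [Finset.sum_boole] at h0
    simp only [x, back, Bool.false_eq_true, if_false] at h0
    simp only [Finset.mem_filter, Finset.mem_univ, true_and]
    exact_mod_cast h0.ge

/-- The Edmonds–Giles conjecture is equivalent to: every `τ`-SCO decomposes into `τ` SCOs. -/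
theorem edmonds_giles_iff_sco_decomp : EdmondsGilesConj ↔ SCODecompProp := by
  exact ⟨EdmondsGilesConj.scoDecompProp, SCODecompProp.edmondsGilesConj⟩
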